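/- Lemma 5.3. Let U ⊆ ℝⁿ (n ≥ 1) be a bounded open set and let (u₁, u₂) be a pair of continuous real functions on the closure of U that is a viscosity solution of the system −Δ∞u₁ + u₁ − u₂ = 0, −Δ∞u₂ + u₂ − u₁ = 0 in U. Then for every x₀ ∈ U, every 0 < s ≤ r with B̄(x₀,r) ⊆ U, and every i ∈ {1,2} with j := 3 − i: SC_i⁺(x₀,s) ≤ (1/2)(1 + ξ(s)/ξ(r))·SC_i⁺(x₀,r) + (1/2)(1 − ξ(s)/ξ(r))·SC_j⁺(x₀,r), and SC_i⁻(x₀,s) ≥ (1/2)(1 + ξ(s)/ξ(r))·SC_i⁻(x₀,r) + (1/2)(1 − ξ(s)/ξ(r))·SC_j⁻(x₀,r), where ξ(r) := (e^{√2 r} − e^{−√2 r})/r. -/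

import Mathlib

open Filter Metric Set Topology

noncomputable def secondDeriv {n : ℕ} (φ : EuclideanSpace ℝ (Fin n) → ℝ)
    (x v : EuclideanSpace ℝ (Fin n)) : ℝ :=
  iteratedFDeriv ℝ 2 φ x ![v, v]

open scoped Classical in
noncomputable def laplInfPlus {n : ℕ} (φ : EuclideanSpace ℝ (Fin n) → ℝ)
    (x : EuclideanSpace ℝ (Fin n)) : ℝ :=
  if gradient φ x = 0 then
    sSup {t : ℝ | ∃ v : EuclideanSpace ℝ (Fin n), ‖v‖ = 1 ∧ t = secondDeriv φ x v}
  else secondDeriv φ x (gradient φ x) / ‖gradient φ x‖ ^ 2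

open scoped Classical in
noncomputable def laplInfMinus {n : ℕ} (φ : EuclideanSpace ℝ (Fin n) → ℝ)
    (x : EuclideanSpace ℝ (Fin n)) : ℝ :=
  if gradient φ x = 0 then
    sInf {t : ℝ | ∃ v : EuclideanSpace ℝ (Fin n), ‖v‖ = 1 ∧ t = secondDeriv φ x v}
  else secondDeriv φ x (gradient φ x) / ‖gradient φ x‖ ^ 2

/-- One half of the subsolution condition: `-Δ∞⁺φ(x₀) + u(x₀) - v(x₀) ≤ 0` at
local maximum points of `u - φ`. -/
def SubPair {n : ℕ} (U : Set (EuclideanSpace ℝ (Fin n)))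
    (u v : EuclideanSpace ℝ (Fin n) → ℝ) : Prop :=
  ∀ φ : EuclideanSpace ℝ (Fin n) → ℝ, ContDiff ℝ 2 φ →
    ∀ x₀ ∈ U, IsLocalMaxOn (fun x => u x - φ x) U x₀ →
      -laplInfPlus φ x₀ + u x₀ - v x₀ ≤ 0

def SuperPair {n : ℕ} (U : Set (EuclideanSpace ℝ (Fin n)))
    (u v : EuclideanSpace ℝ (Fin n) → ℝ) : Prop :=
  ∀ φ : EuclideanSpace ℝ (Fin n) → ℝ, ContDiff ℝ 2 φ →
    ∀ x₀ ∈ U, IsLocalMinOn (fun x => u x - φ x) U x₀ →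
      0 ≤ -laplInfMinus φ x₀ + u x₀ - v x₀

/-- `(u₁, u₂)` is a viscosity subsolution of the system
`-Δ∞u₁ + u₁ - u₂ = 0`, `-Δ∞u₂ + u₂ - u₁ = 0` in `U`. -/
def IsSubsolution {n : ℕ} (U : Set (EuclideanSpace ℝ (Fin n)))
    (u₁ u₂ : EuclideanSpace ℝ (Fin n) → ℝ) : Prop :=
  UpperSemicontinuousOn u₁ U ∧ UpperSemicontinuousOn u₂ U ∧
    SubPair U u₁ u₂ ∧ SubPair U u₂ u₁

/-- `(u₁, u₂)` is a viscosity supersolution of the system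
`-Δ∞u₁ + u₁ - u₂ = 0`, `-Δ∞u₂ + u₂ - u₁ = 0` in `U`. -/
def IsSupersolution {n : ℕ} (U : Set (EuclideanSpace ℝ (Fin n)))
    (u₁ u₂ : EuclideanSpace ℝ (Fin n) → ℝ) : Prop :=
  LowerSemicontinuousOn u₁ U ∧ LowerSemicontinuousOn u₂ U ∧
    SuperPair U u₁ u₂ ∧ SuperPair U u₂ u₁

def IsSolution {n : ℕ} (U : Set (EuclideanSpace ℝ (Fin n)))
    (u₁ u₂ : EuclideanSpace ℝ (Fin n) → ℝ) : Prop :=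
  IsSubsolution U u₁ u₂ ∧ IsSupersolution U u₁ u₂

/-- First component of the generalized cone pair with vertex `x₀`. -/
noncomputable def cone₁ {n : ℕ} (x₀ : EuclideanSpace ℝ (Fin n)) (C₁ C₂ a b : ℝ)
    (x : EuclideanSpace ℝ (Fin n)) : ℝ :=
  C₁ * Real.exp (Real.sqrt 2 * ‖x - x₀‖) + C₂ * Real.exp (-(Real.sqrt 2 * ‖x - x₀‖)) +
    a * ‖x - x₀‖ + b

/-- Second component of the generalized cone pair with vertex `x₀`. -/
noncomputable def cone₂ {n : ℕ} (x₀ : EuclideanSpace ℝ (Fin n)) (C₁ C₂ a b : ℝ)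
    (x : EuclideanSpace ℝ (Fin n)) : ℝ :=
  -C₁ * Real.exp (Real.sqrt 2 * ‖x - x₀‖) - C₂ * Real.exp (-(Real.sqrt 2 * ‖x - x₀‖)) +
    a * ‖x - x₀‖ + b

noncomputable def sphMax {n : ℕ} (u : EuclideanSpace ℝ (Fin n) → ℝ)
    (x₀ : EuclideanSpace ℝ (Fin n)) (r : ℝ) : ℝ :=
  sSup (u '' sphere x₀ r)

noncomputable def sphMin {n : ℕ} (u : EuclideanSpace ℝ (Fin n) → ℝ)
    (x₀ : EuclideanSpace ℝ (Fin n)) (r : ℝ) : ℝ :=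
  sInf (u '' sphere x₀ r)

noncomputable def Splus {n : ℕ} (u : EuclideanSpace ℝ (Fin n) → ℝ)
    (x₀ : EuclideanSpace ℝ (Fin n)) (r : ℝ) : ℝ :=
  (sphMax u x₀ r - u x₀) / r

noncomputable def Sminus {n : ℕ} (u : EuclideanSpace ℝ (Fin n) → ℝ)
    (x₀ : EuclideanSpace ℝ (Fin n)) (r : ℝ) : ℝ :=
  (sphMin u x₀ r - u x₀) / r


noncomputable def xi (r : ℝ) : ℝ :=
  (Real.exp (Real.sqrt 2 * r) - Real.exp (-(Real.sqrt 2 * r))) / r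

noncomputable def SCplus {n : ℕ} (u v : EuclideanSpace ℝ (Fin n) → ℝ) (x₀ : EuclideanSpace ℝ (Fin n)) (r : ℝ) : ℝ :=
  Splus u x₀ r + ((u x₀ - v x₀) / 2) * ((1 - Real.exp (-(Real.sqrt 2 * r))) / r)

noncomputable def SCminus {n : ℕ} (u v : EuclideanSpace ℝ (Fin n) → ℝ) (x₀ : EuclideanSpace ℝ (Fin n)) (r : ℝ) : ℝ :=
  Sminus u x₀ r + ((u x₀ - v x₀) / 2) * ((1 - Real.exp (-(Real.sqrt 2 * r))) / r)

/-- A quadratic polynomial in the squared distance to `x₀`, expanded around `z`. -/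
noncomputable def radialQuadratic {n : ℕ} (x₀ : EuclideanSpace ℝ (Fin n)) (α β γ z : ℝ)
    (x : EuclideanSpace ℝ (Fin n)) : ℝ :=
  α + β * (‖x - x₀‖ ^ 2 - z) + γ / 2 * (‖x - x₀‖ ^ 2 - z) ^ 2

lemma contDiff_radialQuadratic {n : ℕ} (x₀ : EuclideanSpace ℝ (Fin n)) (α β γ z : ℝ) :
    ContDiff ℝ 2 (radialQuadratic x₀ α β γ z) := by
  have h : ContDiff ℝ 2 fun x : EuclideanSpace ℝ (Fin n) => ‖x - x₀‖ ^ 2 :=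
    (contDiff_id.sub contDiff_const).norm_sq ℝ
  unfold radialQuadratic
  fun_prop

lemma hasFDerivAt_norm_sub_sq {n : ℕ} (x₀ x : EuclideanSpace ℝ (Fin n)) :
    HasFDerivAt (fun x => ‖x - x₀‖ ^ 2) ((2 : ℝ) • innerSL ℝ (x - x₀)) x := by
  have h := ((hasFDerivAt_id x).sub_const x₀).norm_sq
  refine h.congr_fderiv ?_
  ext v
  simp

lemma hasFDerivAt_radialQuadratic {n : ℕ} (x₀ : EuclideanSpace ℝ (Fin n)) (α β γ z : ℝ)
    (x : EuclideanSpace ℝ (Fin n)) :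
    HasFDerivAt (radialQuadratic x₀ α β γ z)
      ((2 * (β + γ * (‖x - x₀‖ ^ 2 - z))) • innerSL ℝ (x - x₀)) x := by
  have h := (hasFDerivAt_norm_sub_sq x₀ x).sub_const z
  refine (((h.const_mul β).const_add α).add ((h.pow 2).const_mul (γ / 2))).congr_fderiv ?_
  ext v
  simp
  ring

lemma gradient_radialQuadratic {n : ℕ} (x₀ x : EuclideanSpace ℝ (Fin n)) (α β γ : ℝ) :
    gradient (radialQuadratic x₀ α β γ (‖x - x₀‖ ^ 2)) x = (2 * β) • (x - x₀) := by
  refine HasGradientAt.gradient ?_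
  rw [hasGradientAt_iff_hasFDerivAt]
  refine (hasFDerivAt_radialQuadratic x₀ α β γ _ x).congr_fderiv ?_
  ext v
  simp

lemma secondDeriv_radialQuadratic {n : ℕ} (x₀ x v : EuclideanSpace ℝ (Fin n)) (α β γ : ℝ) :
    secondDeriv (radialQuadratic x₀ α β γ (‖x - x₀‖ ^ 2)) x v =
      2 * β * ‖v‖ ^ 2 + 4 * γ * inner ℝ (x - x₀) v ^ 2 := by
  have h1 : fderiv ℝ (radialQuadratic x₀ α β γ (‖x - x₀‖ ^ 2)) = fun y =>
      (2 * (β + γ * (‖y - x₀‖ ^ 2 - ‖x - x₀‖ ^ 2))) • innerSL ℝ (y - x₀) := by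
    funext y
    exact (hasFDerivAt_radialQuadratic x₀ α β γ _ y).fderiv
  have h2 := ((((hasFDerivAt_norm_sub_sq x₀ x).sub_const (‖x - x₀‖ ^ 2)).const_mul γ).const_add
    β).const_mul 2
  have h3 : HasFDerivAt (fun y => innerSL ℝ (y - x₀)) (innerSL ℝ (E := EuclideanSpace ℝ (Fin n)))
      x := by
    have h := (innerSL ℝ (E := EuclideanSpace ℝ (Fin n))).hasFDerivAt.comp x
      ((hasFDerivAt_id x).sub_const x₀)
    rw [ContinuousLinearMap.comp_id] at h
    exact h
  have h4 := h2.smul h3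
  rw [secondDeriv, iteratedFDeriv_two_apply, h1]
  have h5 := congrArg (fun L => L v v) h4.fderiv
  refine h5.trans ?_
  have h6 : innerSL ℝ v v = ‖v‖ ^ 2 := real_inner_self_eq_norm_sq v
  simp [h6, inner_sub_left]
  ring

/-- Testing a subsolution with a radial function: touching from above at a point off the centre
bounds the zeroth-order term by the second radial derivative, up to an arbitrary slack, and by
its positive part at critical points. -/
lemma SubPair.le_of_isLocalMax_radial {n : ℕ} {U : Set (EuclideanSpace ℝ (Fin n))}
    {u v : EuclideanSpace ℝ (Fin n) → ℝ} (h : SubPair U u v) {x₀ x : EuclideanSpace ℝ (Fin n)}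
    (hx : x ∈ U) (hne : x ≠ x₀) {A A' : ℝ → ℝ} {A'' κ : ℝ} (hA : ∀ ρ, HasDerivAt A (A' ρ) ρ)
    (hA' : HasDerivAt A' A'' ‖x - x₀‖) (hκ : 0 < κ)
    (hmax : IsLocalMax (fun y => u y - A ‖y - x₀‖) x) :
    u x - v x ≤ A'' + κ ∨ (A' ‖x - x₀‖ = 0 ∧ u x - v x ≤ 0) := by
  set ρ := ‖x - x₀‖ with hρ
  have hρ0 : 0 < ρ := norm_pos_iff.2 (sub_ne_zero.2 hne)
  set β := A' ρ / (2 * ρ) with hβ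
  set γ := (A'' + κ - 2 * β) / (4 * ρ ^ 2) with hγ
  have hβ' : 2 * ρ * β = A' ρ := by rw [hβ]; field_simp
  have hγ' : 4 * γ * ρ ^ 2 = A'' + κ - 2 * β := by rw [hγ]; field_simp
  set G : ℝ → ℝ := fun s => A ρ + β * (s ^ 2 - ρ ^ 2) + γ / 2 * (s ^ 2 - ρ ^ 2) ^ 2 with hG
  have hd1 : ∀ s, HasDerivAt (fun s => G s - A s)
      (2 * s * β + 2 * s * γ * (s ^ 2 - ρ ^ 2) - A' s) s := by
    intro s
    have h1 := ((hasDerivAt_id s).pow 2).sub_const (ρ ^ 2)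
    refine ((((h1.const_mul β).const_add (A ρ)).add ((h1.pow 2).const_mul (γ / 2))).sub
      (hA s)).congr_deriv ?_
    simp
    ring
  have hd1' : deriv (fun s => G s - A s) =
      fun s => 2 * s * β + 2 * s * γ * (s ^ 2 - ρ ^ 2) - A' s := funext fun s => (hd1 s).deriv
  have hd2 : HasDerivAt (fun s => 2 * s * β + 2 * s * γ * (s ^ 2 - ρ ^ 2) - A' s) κ ρ := by
    have h1 := ((hasDerivAt_id ρ).pow 2).sub_const (ρ ^ 2)
    have h2 := (hasDerivAt_id ρ).const_mul 2
    refine (((h2.mul_const β).add ((h2.mul_const γ).mul h1)).sub hA').congr_deriv ?_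
    simp
    linear_combination hγ'
  have hmin : IsLocalMin (fun s => G s - A s) ρ := by
    refine isLocalMin_of_deriv_deriv_pos ?_ ?_ (hd1 ρ).continuousAt
    · rw [hd1', hd2.deriv]; exact hκ
    · rw [hd1']; simp; linarith
  have hcont : Tendsto (fun y : EuclideanSpace ℝ (Fin n) => ‖y - x₀‖) (𝓝 x) (𝓝 ρ) :=
    Continuous.tendsto (by fun_prop) x
  have hloc : IsLocalMaxOn (fun y => u y - radialQuadratic x₀ (A ρ) β γ (ρ ^ 2) y) U x := by
    refine IsLocalMax.on ?_ U
    filter_upwards [hmax, hcont.eventually hmin] with y h1 h2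
    simp only [radialQuadratic, hG, ← hρ] at h1 h2 ⊢
    linarith
  have key := h _ (contDiff_radialQuadratic x₀ (A ρ) β γ (ρ ^ 2)) x hx hloc
  have hgrad := gradient_radialQuadratic x₀ x (A ρ) β γ
  have hsec := fun w => secondDeriv_radialQuadratic x₀ x w (A ρ) β γ
  rw [← hρ] at hgrad hsec
  rw [laplInfPlus, hgrad] at key
  by_cases hb : β = 0
  · rw [if_pos (by simp [hb])] at key
    have hA0 : A' ρ = 0 := by rw [← hβ', hb, mul_zero]
    have hle : sSup {t : ℝ | ∃ w : EuclideanSpace ℝ (Fin n), ‖w‖ = 1 ∧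
        t = secondDeriv (radialQuadratic x₀ (A ρ) β γ (ρ ^ 2)) x w} ≤ max (A'' + κ) 0 := by
      refine Real.sSup_le ?_ (le_max_right _ _)
      rintro t ⟨w, hw, rfl⟩
      rw [hsec, hb]
      have hi : inner ℝ (x - x₀) w ^ 2 ≤ ρ ^ 2 := by
        have := abs_real_inner_le_norm (x - x₀) w
        rw [hw, mul_one, ← hρ] at this
        exact sq_le_sq' (abs_le.1 this).1 (abs_le.1 this).2
      rcases le_or_gt 0 γ with hg | hg
      · refine le_max_of_le_left ?_
        rw [hb] at hγ'
        nlinarith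
      · refine le_max_of_le_right ?_
        nlinarith [sq_nonneg (inner ℝ (x - x₀) w)]
    rcases max_cases (A'' + κ) 0 with ⟨h1, -⟩ | ⟨h1, -⟩
    · left; linarith
    · right; exact ⟨hA0, by linarith⟩
  · left
    have hv : (2 * β) • (x - x₀) ≠ 0 :=
      smul_ne_zero (mul_ne_zero two_ne_zero hb) (sub_ne_zero.2 hne)
    rw [if_neg hv, hsec, inner_smul_right, real_inner_self_eq_norm_sq, norm_smul, ← hρ,
      Real.norm_eq_abs, mul_pow, sq_abs] at key
    have : (2 * β * ((2 * β) ^ 2 * ρ ^ 2) + 4 * γ * (2 * β * ρ ^ 2) ^ 2) /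
        ((2 * β) ^ 2 * ρ ^ 2) = A'' + κ := by
      rw [div_eq_iff (by positivity)]
      linear_combination (2 * β) ^ 2 * ρ ^ 2 * hγ'
    linarith

/-- The profile `C₁ e^{√2 ρ} + C₂ e^{-√2 ρ}`, half the difference of the components of a cone. -/
noncomputable def expProfile (C₁ C₂ ρ : ℝ) : ℝ :=
  C₁ * Real.exp (√2 * ρ) + C₂ * Real.exp (-(√2 * ρ))

/-- A cone profile perturbed by the concave term `η ρ (r - ρ)`. -/
noncomputable def bentCone (C₁ C₂ a b η r ρ : ℝ) : ℝ :=
  expProfile C₁ C₂ ρ + a * ρ + b + η * (ρ * (r - ρ))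

noncomputable def bentConeDeriv (C₁ C₂ a η r ρ : ℝ) : ℝ :=
  √2 * expProfile C₁ (-C₂) ρ + a + η * (r - 2 * ρ)

lemma hasDerivAt_expProfile (C₁ C₂ ρ : ℝ) :
    HasDerivAt (expProfile C₁ C₂) (√2 * expProfile C₁ (-C₂) ρ) ρ := by
  have h := (hasDerivAt_id ρ).const_mul √2
  refine ((h.exp.const_mul C₁).add (h.neg.exp.const_mul C₂)).congr_deriv ?_
  simp [expProfile]
  ring

lemma hasDerivAt_bentCone (C₁ C₂ a b η r ρ : ℝ) :
    HasDerivAt (bentCone C₁ C₂ a b η r) (bentConeDeriv C₁ C₂ a η r ρ) ρ := by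
  have h := hasDerivAt_id ρ
  refine ((((hasDerivAt_expProfile C₁ C₂ ρ).add (h.const_mul a)).add_const b).add
    ((h.mul (h.const_sub r)).const_mul η)).congr_deriv ?_
  simp only [bentConeDeriv, id_eq]
  ring

lemma hasDerivAt_bentConeDeriv (C₁ C₂ a η r ρ : ℝ) :
    HasDerivAt (bentConeDeriv C₁ C₂ a η r) (2 * expProfile C₁ C₂ ρ - 2 * η) ρ := by
  have h := (((hasDerivAt_id ρ).const_mul 2).const_sub r).const_mul η
  refine ((((hasDerivAt_expProfile C₁ (-C₂) ρ).const_mul √2).add_const a).add h).congr_deriv ?_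
  have h2 : √2 * √2 = 2 := Real.mul_self_sqrt zero_le_two
  simp only [neg_neg]
  linear_combination expProfile C₁ C₂ ρ * h2

/-- Positive sublevel sets of solutions of `q'' = 2 q` are convex. -/
lemma expProfile_lt_of_mem_Icc {C₁ C₂ η s t ρ : ℝ} (hη : 0 < η) (hs : expProfile C₁ C₂ s < η)
    (ht : expProfile C₁ C₂ t < η) (hρ : ρ ∈ Icc s t) : expProfile C₁ C₂ ρ < η := by
  have hE : ∀ σ, expProfile C₁ C₂ σ * Real.exp (√2 * σ) = C₁ * Real.exp (√2 * σ) ^ 2 + C₂ := by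
    intro σ
    rw [expProfile, Real.exp_neg]
    field_simp
  have hsρ : Real.exp (√2 * s) ≤ Real.exp (√2 * ρ) := by gcongr; exact hρ.1
  have hρt : Real.exp (√2 * ρ) ≤ Real.exp (√2 * t) := by gcongr; exact hρ.2
  have h1 := mul_lt_mul_of_pos_right hs (Real.exp_pos (√2 * s))
  have h2 := mul_lt_mul_of_pos_right ht (Real.exp_pos (√2 * t))
  by_contra! hc
  have h3 := mul_le_mul_of_nonneg_right hc (Real.exp_pos (√2 * ρ)).le
  rw [hE] at h1 h2 h3
  have hx := Real.exp_pos (√2 * s)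
  generalize Real.exp (√2 * s) = x at *
  generalize Real.exp (√2 * t) = z at *
  generalize Real.exp (√2 * ρ) = y at *
  rcases le_or_gt 0 C₁ with hC | hC
  · rcases hsρ.eq_or_lt with rfl | hlt
    · linarith
    have e1 := mul_le_mul_of_nonneg_left h1.le (sub_nonneg.2 hρt)
    have e2 := mul_lt_mul_of_pos_left h2 (sub_pos.2 hlt)
    have e3 := mul_le_mul_of_nonneg_left h3 (sub_nonneg.2 (hsρ.trans hρt))
    have e4 := mul_nonneg hC (mul_nonneg (mul_nonneg (sub_nonneg.2 hρt) (sub_nonneg.2 hsρ))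
      (sub_nonneg.2 (hsρ.trans hρt)))
    nlinarith
  · have hy : x ^ 2 ≤ y ^ 2 := by gcongr
    have e1 := mul_le_mul_of_nonpos_left hy hC.le
    have e2 := mul_le_mul_of_nonneg_left hsρ hη.le
    linarith

/-- A critical maximum of `u` minus a tilted bent cone, in the range where the cone is concave. -/
def HasConcaveTouching {n : ℕ} (u : EuclideanSpace ℝ (Fin n) → ℝ)
    (x₀ : EuclideanSpace ℝ (Fin n)) (C₁ C₂ a b η r t : ℝ) : Prop :=
  ∃ x ∈ closedBall x₀ r,
    IsMaxOn (fun y => u y - bentCone C₁ C₂ (a + t) b η r ‖y - x₀‖) (closedBall x₀ r) x ∧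
    bentConeDeriv C₁ C₂ (a + t) η r ‖x - x₀‖ = 0 ∧ expProfile C₁ C₂ ‖x - x₀‖ < η

lemma HasConcaveTouching.not_lt {n : ℕ} {u : EuclideanSpace ℝ (Fin n) → ℝ}
    {x₀ : EuclideanSpace ℝ (Fin n)} {C₁ C₂ a b η r s t : ℝ} (hη : 0 < η)
    (hs : HasConcaveTouching u x₀ C₁ C₂ a b η r s)
    (ht : HasConcaveTouching u x₀ C₁ C₂ a b η r t) : ¬ s < t := by
  intro hst
  obtain ⟨x, hx, hxm, hxd, hxq⟩ := hs
  obtain ⟨y, hy, hym, hyd, hyq⟩ := ht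
  have h1 := hxm hy
  have h2 := hym hx
  simp only [mem_ofPred_eq, bentCone] at h1 h2
  have hle : ‖y - x₀‖ ≤ ‖x - x₀‖ := by nlinarith
  have hanti : AntitoneOn (bentConeDeriv C₁ C₂ a η r) (Icc ‖y - x₀‖ ‖x - x₀‖) := by
    have hd := hasDerivAt_bentConeDeriv C₁ C₂ a η r
    refine antitoneOn_of_deriv_nonpos (convex_Icc _ _)
      (fun ρ _ => (hd ρ).continuousAt.continuousWithinAt)
      (fun ρ _ => (hd ρ).differentiableAt.differentiableWithinAt) fun ρ hρ => ?_
    rw [(hd ρ).deriv]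
    linarith [expProfile_lt_of_mem_Icc hη hyq hxq (interior_subset hρ)]
  have h3 := hanti (left_mem_Icc.2 hle) (right_mem_Icc.2 hle) hle
  simp only [bentConeDeriv] at h3 hxd hyd
  linarith

lemma SubPair.hasConcaveTouching {n : ℕ} {U : Set (EuclideanSpace ℝ (Fin n))}
    {u v : EuclideanSpace ℝ (Fin n) → ℝ} (h : SubPair U u v) {x₀ x : EuclideanSpace ℝ (Fin n)}
    {C₁ C₂ a b η r t : ℝ} (hη : 0 < η) (hU : closedBall x₀ r ⊆ U) (hx : x ∈ ball x₀ r)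
    (hne : x ≠ x₀)
    (hmax : IsMaxOn (fun y => u y - bentCone C₁ C₂ (a + t) b η r ‖y - x₀‖) (closedBall x₀ r) x)
    (huv : v x - bentCone (-C₁) (-C₂) (a + t) b η r ‖x - x₀‖ ≤
      u x - bentCone C₁ C₂ (a + t) b η r ‖x - x₀‖) :
    HasConcaveTouching u x₀ C₁ C₂ a b η r t := by
  have hxc := ball_subset_closedBall hx
  have key := h.le_of_isLocalMax_radial (hU hxc) hne (hasDerivAt_bentCone C₁ C₂ (a + t) b η r)
    (hasDerivAt_bentConeDeriv C₁ C₂ (a + t) η r ‖x - x₀‖) hη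
    (hmax.isLocalMax (mem_of_superset (isOpen_ball.mem_nhds hx) ball_subset_closedBall))
  have hq : 2 * expProfile C₁ C₂ ‖x - x₀‖ ≤ u x - v x := by
    simp only [bentCone, expProfile] at huv ⊢
    linarith
  rcases key with h1 | ⟨h1, h2⟩
  · linarith
  · exact ⟨x, hxc, hmax, h1, by linarith⟩

/-- Comparison with generalized cones from above. -/
lemma SubPair.le_cone {n : ℕ} {U : Set (EuclideanSpace ℝ (Fin n))}
    {u v : EuclideanSpace ℝ (Fin n) → ℝ} (huv : SubPair U u v) (hvu : SubPair U v u)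
    {x₀ : EuclideanSpace ℝ (Fin n)} {r : ℝ} (hr : 0 < r) (hU : closedBall x₀ r ⊆ U)
    (hu : ContinuousOn u (closedBall x₀ r)) (hv : ContinuousOn v (closedBall x₀ r))
    {C₁ C₂ a b : ℝ} (hu0 : u x₀ ≤ expProfile C₁ C₂ 0 + b)
    (hv0 : v x₀ ≤ expProfile (-C₁) (-C₂) 0 + b)
    (hur : ∀ y ∈ sphere x₀ r, u y ≤ expProfile C₁ C₂ r + a * r + b)
    (hvr : ∀ y ∈ sphere x₀ r, v y ≤ expProfile (-C₁) (-C₂) r + a * r + b)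
    {x : EuclideanSpace ℝ (Fin n)} (hx : x ∈ closedBall x₀ r) :
    u x ≤ expProfile C₁ C₂ ‖x - x₀‖ + a * ‖x - x₀‖ + b := by
  by_contra! hlt
  set δ := u x - (expProfile C₁ C₂ ‖x - x₀‖ + a * ‖x - x₀‖ + b) with hδ
  have hδ0 : 0 < δ := by linarith
  set η := δ / (4 * r ^ 2) with hη
  set τ := δ / (8 * r) with hτ
  have hη0 : 0 < η := by positivity
  have hτ0 : 0 < τ := by positivity
  have hηr : η * (r * r) = δ / 4 := by rw [hη]; field_simp
  have hτr : τ * r = δ / 8 := by rw [hτ]; field_simp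
  have hxr : ‖x - x₀‖ ≤ r := by simpa [dist_eq_norm] using hx
  have alt : ∀ t, 0 ≤ t → t ≤ 2 * τ → HasConcaveTouching u x₀ C₁ C₂ a b η r t ∨
      HasConcaveTouching v x₀ (-C₁) (-C₂) a b η r t := by
    intro t ht0 ht
    have hcone : ∀ D₁ D₂, Continuous fun y : EuclideanSpace ℝ (Fin n) =>
        bentCone D₁ D₂ (a + t) b η r ‖y - x₀‖ := by
      intro D₁ D₂
      unfold bentCone expProfile
      fun_prop
    set f := fun y => u y - bentCone C₁ C₂ (a + t) b η r ‖y - x₀‖ with hf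
    set g := fun y => v y - bentCone (-C₁) (-C₂) (a + t) b η r ‖y - x₀‖ with hg
    have hfc : ContinuousOn f (closedBall x₀ r) := hu.sub (hcone _ _).continuousOn
    have hgc : ContinuousOn g (closedBall x₀ r) := hv.sub (hcone _ _).continuousOn
    obtain ⟨y, hy, hym⟩ := (isCompact_closedBall x₀ r).exists_isMaxOn ⟨x, hx⟩ (hfc.sup hgc)
    have hfx : 0 < f x := by
      have h1 : t * ‖x - x₀‖ ≤ 2 * τ * r := by gcongr
      have h2 : η * (‖x - x₀‖ * (r - ‖x - x₀‖)) ≤ η * (r * r) := by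
        have := norm_nonneg (x - x₀)
        gcongr
        linarith
      simp only [hf, bentCone]
      linarith
    have hpos : 0 < max (f y) (g y) := hfx.trans_le ((le_max_left _ _).trans (hym hx))
    have hne : y ≠ x₀ := by
      rintro rfl
      refine absurd hpos (not_lt.2 (max_le ?_ ?_)) <;> simp [hf, hg, bentCone] <;> linarith
    have hyb : y ∈ ball x₀ r := by
      rcases (mem_closedBall.1 hy).lt_or_eq with h1 | h1
      · exact h1
      · have h2 := hur y h1
        have h3 := hvr y h1
        rw [dist_eq_norm] at h1
        have h4 := mul_nonneg ht0 hr.le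
        refine absurd hpos (not_lt.2 (max_le ?_ ?_)) <;> simp only [hf, hg, bentCone, h1] <;>
          linarith
    rcases le_total (g y) (f y) with h1 | h1
    · refine Or.inl (huv.hasConcaveTouching hη0 hU hyb hne (fun w hw => ?_) h1)
      have := hym hw
      simp only [mem_ofPred_eq] at this
      exact (le_max_left _ _).trans (this.trans_eq (max_eq_left h1))
    · refine Or.inr (hvu.hasConcaveTouching hη0 hU hyb hne (fun w hw => ?_) ?_)
      · have := hym hw
        simp only [mem_ofPred_eq] at this
        exact (le_max_right _ _).trans (this.trans_eq (max_eq_right h1))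
      · simpa only [neg_neg] using h1
  have h01 : (0 : ℝ) < τ := hτ0
  have h12 : τ < 2 * τ := by linarith
  rcases alt 0 le_rfl (by linarith) with h0 | h0 <;>
  rcases alt τ hτ0.le (by linarith) with h1 | h1 <;>
  rcases alt (2 * τ) (by linarith) le_rfl with h2 | h2
  all_goals first
    | exact h0.not_lt hη0 h1 h01
    | exact h1.not_lt hη0 h2 h12
    | exact h0.not_lt hη0 h2 (h01.trans h12)

lemma SubPair.SCplus_le {n : ℕ} (hn : 1 ≤ n) {U : Set (EuclideanSpace ℝ (Fin n))}
    {u v : EuclideanSpace ℝ (Fin n) → ℝ} (huv : SubPair U u v) (hvu : SubPair U v u)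
    {x₀ : EuclideanSpace ℝ (Fin n)} {s r : ℝ} (hs : 0 < s) (hsr : s ≤ r)
    (hU : closedBall x₀ r ⊆ U) (hu : ContinuousOn u U) (hv : ContinuousOn v U) :
    SCplus u v x₀ s ≤ (1 / 2) * (1 + xi s / xi r) * SCplus u v x₀ r +
      (1 / 2) * (1 - xi s / xi r) * SCplus v u x₀ r := by
  have hr : 0 < r := hs.trans_le hsr
  have : Nonempty (Fin n) := ⟨⟨0, hn⟩⟩
  have : Nontrivial (EuclideanSpace ℝ (Fin n)) := inferInstance
  have hle : ∀ w : EuclideanSpace ℝ (Fin n) → ℝ, ContinuousOn w U →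
      ∀ y ∈ sphere x₀ r, w y ≤ sphMax w x₀ r := fun w hw y hy =>
    le_csSup ((isCompact_sphere x₀ r).bddAbove_image
      (hw.mono (sphere_subset_closedBall.trans hU))) (mem_image_of_mem w hy)
  have hxi : 0 < xi r := by
    have : 0 < √2 * r := by positivity
    refine div_pos (sub_pos.2 (Real.exp_lt_exp.2 ?_)) hr
    linarith
  set d := (u x₀ - v x₀) / 2 with hd
  set a := (SCplus u v x₀ r + SCplus v u x₀ r) / 2 with ha
  set C := (SCplus u v x₀ r - SCplus v u x₀ r) / (2 * xi r) with hC
  set b := (u x₀ + v x₀) / 2 with hb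
  have hCx : C * xi r = (SCplus u v x₀ r - SCplus v u x₀ r) / 2 := by rw [hC]; field_simp
  have hprof : ∀ (D e ρ : ℝ), 0 < ρ →
      expProfile D (e - D) ρ = D * xi ρ * ρ + e * Real.exp (-(√2 * ρ)) := by
    intro D e ρ hρ
    rw [expProfile, xi]
    field_simp
    ring
  have hSC : ∀ (w z : EuclideanSpace ℝ (Fin n) → ℝ) (ρ : ℝ), 0 < ρ →
      SCplus w z x₀ ρ * ρ = sphMax w x₀ ρ - w x₀ +
        (w x₀ - z x₀) / 2 * (1 - Real.exp (-(√2 * ρ))) := by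
    intro w z ρ hρ
    rw [SCplus, Splus]
    field_simp
  have e1 := hSC u v r hr
  have e2 := hSC v u r hr
  have e3 := hSC u v s hs
  have hneg : -(d - C) = -d - -C := by ring
  have hM : sphMax u x₀ s ≤ expProfile C (d - C) s + a * s + b := by
    refine csSup_le ((NormedSpace.sphere_nonempty.2 hs.le).image u) ?_
    rintro _ ⟨y, hy, rfl⟩
    have hyn : ‖y - x₀‖ = s := by rw [← dist_eq_norm]; exact hy
    have hyr : y ∈ closedBall x₀ r := (mem_closedBall.2 ((mem_sphere.1 hy).trans_le hsr))
    rw [← hyn]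
    refine huv.le_cone hvu hr hU (hu.mono hU) (hv.mono hU) ?_ ?_ ?_ ?_ hyr
    · simp only [expProfile, mul_zero, neg_zero, Real.exp_zero]; linarith
    · simp only [expProfile, mul_zero, neg_zero, Real.exp_zero]; linarith
    · intro w hw
      refine (hle u hu w hw).trans ?_
      rw [hprof _ _ _ hr, hCx, hd, ha, hb]
      linarith
    · intro w hw
      refine (hle v hv w hw).trans ?_
      rw [hneg, hprof _ _ _ hr, neg_mul, hCx, hd, ha, hb]
      linarith
  rw [hprof _ _ _ hs] at hM
  have h1 : SCplus u v x₀ s ≤ a + C * xi s := by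
    refine le_of_mul_le_mul_right ?_ hs
    rw [e3]
    rw [hd, hb] at hM
    linarith
  refine h1.trans_eq ?_
  rw [ha, hC]
  field_simp
  ring

lemma SuperPair.neg {n : ℕ} {U : Set (EuclideanSpace ℝ (Fin n))}
    {u v : EuclideanSpace ℝ (Fin n) → ℝ} (h : SuperPair U u v) : SubPair U (-u) (-v) := by
  intro φ hφ x hx hmax
  have key := h (-φ) hφ.neg x hx (by
    have := hmax.neg
    have heq : (fun y => -((-u) y - φ y)) = fun y => u y - (-φ) y := by
      funext y
      simp only [Pi.neg_apply]
      ring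
    rwa [← heq])
  have hsd : ∀ w, secondDeriv (-φ) x w = -secondDeriv φ x w := fun w => by
    simp [secondDeriv, iteratedFDeriv_neg]
  have hg : gradient (-φ) x = -gradient φ x := by
    simp [gradient, fderiv_neg]
  have : laplInfMinus (-φ) x = -laplInfPlus φ x := by
    rw [laplInfMinus, laplInfPlus, hg]
    simp only [neg_eq_zero, hsd]
    split_ifs with h0
    · rw [Real.sInf_def]
      congr 2
      ext t
      simp [neg_eq_iff_eq_neg]
    · have : secondDeriv φ x (-gradient φ x) = secondDeriv φ x (gradient φ x) := by
        simp [secondDeriv, iteratedFDeriv_two_apply]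
      rw [this, norm_neg, neg_div]
  rw [this] at key
  simp only [Pi.neg_apply]
  linarith

lemma SCminus_eq_neg {n : ℕ} (u v : EuclideanSpace ℝ (Fin n) → ℝ)
    (x₀ : EuclideanSpace ℝ (Fin n)) (r : ℝ) : SCminus u v x₀ r = -SCplus (-u) (-v) x₀ r := by
  have : sphMin u x₀ r = -sphMax (-u) x₀ r := by
    rw [sphMin, sphMax, Real.sInf_def, ← image_neg_eq_neg, image_image]
    rfl
  simp only [SCminus, SCplus, Sminus, Splus, this, Pi.neg_apply]
  ring

/-- Lemma 5.3: the key coupled monotonicity inequalities for `SC_i^±`. -/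
theorem SC_coupled_monotonicity {n : ℕ} (hn : 1 ≤ n)
    {U : Set (EuclideanSpace ℝ (Fin n))} (hUo : IsOpen U) (hUb : Bornology.IsBounded U)
    {u₁ u₂ : EuclideanSpace ℝ (Fin n) → ℝ}
    (hu₁ : ContinuousOn u₁ (closure U)) (hu₂ : ContinuousOn u₂ (closure U))
    (hsol : IsSolution U u₁ u₂) :
    ∀ x₀ ∈ U, ∀ s r : ℝ, 0 < s → s ≤ r → closedBall x₀ r ⊆ U →
      ∀ u v : EuclideanSpace ℝ (Fin n) → ℝ, ((u = u₁ ∧ v = u₂) ∨ (u = u₂ ∧ v = u₁)) →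
        SCplus u v x₀ s ≤
            (1 / 2) * (1 + xi s / xi r) * SCplus u v x₀ r +
              (1 / 2) * (1 - xi s / xi r) * SCplus v u x₀ r ∧
        (1 / 2) * (1 + xi s / xi r) * SCminus u v x₀ r +
            (1 / 2) * (1 - xi s / xi r) * SCminus v u x₀ r ≤ SCminus u v x₀ s := by
  intro x₀ _ s r hs hsr hU u v huv
  have main : ∀ u v : EuclideanSpace ℝ (Fin n) → ℝ, ContinuousOn u U → ContinuousOn v U →
      SubPair U u v → SubPair U v u → SuperPair U u v → SuperPair U v u →
        SCplus u v x₀ s ≤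
            (1 / 2) * (1 + xi s / xi r) * SCplus u v x₀ r +
              (1 / 2) * (1 - xi s / xi r) * SCplus v u x₀ r ∧
        (1 / 2) * (1 + xi s / xi r) * SCminus u v x₀ r +
            (1 / 2) * (1 - xi s / xi r) * SCminus v u x₀ r ≤ SCminus u v x₀ s := by
    intro u v hu hv h1 h2 h3 h4
    refine ⟨h1.SCplus_le hn h2 hs hsr hU hu hv, ?_⟩
    have := h3.neg.SCplus_le hn h4.neg hs hsr hU hu.neg hv.neg
    simp only [SCminus_eq_neg]
    linarith
  have c₁ := hu₁.mono subset_closure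
  have c₂ := hu₂.mono subset_closure
  obtain ⟨⟨-, -, h1, h2⟩, -, -, h3, h4⟩ := hsol
  rcases huv with ⟨rfl, rfl⟩ | ⟨rfl, rfl⟩
  · exact main _ _ c₁ c₂ h1 h2 h3 h4
  · exact main _ _ c₂ c₁ h2 h1 h4 h3
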